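/- For every integer n ≥ 2, 2·p(2, n) = Σ_{r=1}^{n−1} (dep(r/n) − 1)·σ₀(gcd(r, n)), where σ₀(d) denotes the number of divisors of d. -/

import Mathlib

/-- The slow Farey step `S(a, b) = (min(a, b − a), max(a, b − a))`. -/
def fareyStep : ℕ × ℕ → ℕ × ℕ := fun p => (min p.1 (p.2 - p.1), max p.1 (p.2 - p.1))

/-- The depth `dep(r/n)`: the least `k ≥ 1` such that the two coordinates of
`S^k(r, n)` are equal (the level of the Farey tree on which `r/n` appears). -/
noncomputable def dep (r n : ℕ) : ℕ :=
  sInf {k : ℕ | 1 ≤ k ∧ (fareyStep^[k] (r, n)).1 = (fareyStep^[k] (r, n)).2}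

/-- `(n₁, n₂, k₁, k₂)` represents a partition of `n` into two distinct part sizes
with multiplicities: `n₁ > n₂ ≥ 1`, `k₁, k₂ ≥ 1` and `k₁·n₁ + k₂·n₂ = n`. -/
def IsTwoPart (n : ℕ) (q : ℕ × ℕ × ℕ × ℕ) : Prop :=
  0 < q.2.1 ∧ q.2.1 < q.1 ∧ 0 < q.2.2.1 ∧ 0 < q.2.2.2 ∧
    q.2.2.1 * q.1 + q.2.2.2 * q.2.1 = n

/-- `p(2, n)`, the number of partitions of `n` into two distinct part sizes. -/
noncomputable def p2 (n : ℕ) : ℕ := {q : ℕ × ℕ × ℕ × ℕ | IsTwoPart n q}.ncard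

/-- `p_F(2, n)`, the number of partitions of `n` into two distinct part sizes with
coprime parts and coprime multiplicities (those obtainable from the Farey map). -/
noncomputable def pF2 (n : ℕ) : ℕ :=
  {q : ℕ × ℕ × ℕ × ℕ | IsTwoPart n q ∧
    Nat.gcd q.1 q.2.1 = 1 ∧ Nat.gcd q.2.2.1 q.2.2.2 = 1}.ncard

open Finset in
/-- The quadruples `(x, y, q, s)` of positive integers with `x * q + y * s = n`. -/
def quads (n : ℕ) : Finset (ℕ × ℕ × ℕ × ℕ) :=
  (Icc 1 n ×ˢ Icc 1 n ×ˢ Icc 1 n ×ˢ Icc 1 n).filter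
    fun t => t.1 * t.2.2.1 + t.2.1 * t.2.2.2 = n

theorem mem_quads {n x y q s : ℕ} :
    (x, y, q, s) ∈ quads n ↔ 0 < x ∧ 0 < y ∧ 0 < q ∧ 0 < s ∧ x * q + y * s = n := by
  simp only [quads, Finset.mem_filter, Finset.mem_product, Finset.mem_Icc]
  constructor
  · rintro ⟨⟨hx, hy, hq, hs⟩, h⟩
    exact ⟨hx.1, hy.1, hq.1, hs.1, h⟩
  · rintro ⟨hx, hy, hq, hs, h⟩
    have h₁ := Nat.le_mul_of_pos_right x hq
    have h₂ := Nat.le_mul_of_pos_left q hx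
    have h₃ := Nat.le_mul_of_pos_right y hs
    have h₄ := Nat.le_mul_of_pos_left s hy
    exact ⟨⟨⟨hx, by omega⟩, ⟨hy, by omega⟩, ⟨hq, by omega⟩, hs, by omega⟩, h⟩

theorem exists_iterate_fareyStep_eq {a b : ℕ} (ha : 0 < a) (hab : a < b) :
    ∃ k, 1 ≤ k ∧ (fareyStep^[k] (a, b)).1 = (fareyStep^[k] (a, b)).2 := by
  induction b using Nat.strong_induction_on generalizing a with
  | _ b ih =>
    by_cases h : a = b - a
    · exact ⟨1, le_rfl, by simp [fareyStep, ← h]⟩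
    · obtain ⟨k, -, hk⟩ := ih (max a (b - a)) (by omega) (a := min a (b - a)) (by omega) (by omega)
      exact ⟨k + 1, by omega, hk⟩

theorem dep_pos {a b : ℕ} (ha : 0 < a) (hab : a < b) : 1 ≤ dep a b :=
  (Nat.sInf_mem (exists_iterate_fareyStep_eq ha hab)).1

theorem dep_self_add_self {a : ℕ} (ha : 0 < a) : dep a (a + a) = 1 :=
  le_antisymm (Nat.sInf_le ⟨le_rfl, by simp [fareyStep]⟩) (dep_pos ha (by omega))

theorem dep_add_of_lt {x y : ℕ} (hx : 0 < x) (hxy : x < y) :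
    dep x (x + y) = dep x y + 1 := by
  have h := Nat.sInf_add (n := 1)
    (p := fun k => 1 ≤ k ∧ (fareyStep^[k] (x, x + y)).1 = (fareyStep^[k] (x, x + y)).2)
    (dep_pos hx (by omega : x < x + y))
  have hstep : fareyStep (x, x + y) = (x, y) := by
    simp [fareyStep, hxy.le]
  rw [dep, ← h, dep]
  congr 2
  ext k
  cases k with
  | zero => simp [hstep, hxy.ne]
  | succ k => simp [Function.iterate_succ_apply, hstep]

theorem dep_add_comm (x y : ℕ) : dep x (x + y) = dep y (x + y) := by
  have hstep : fareyStep (x, x + y) = fareyStep (y, x + y) := by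
    simp [fareyStep, min_comm, max_comm]
  unfold dep
  congr 1
  ext k
  cases k with
  | zero => simp
  | succ k => simp only [Set.mem_ofPred_eq, Function.iterate_succ_apply, hstep]

theorem iterate_fareyStep_mul (d k : ℕ) (p : ℕ × ℕ) :
    fareyStep^[k] (d * p.1, d * p.2) =
      (d * (fareyStep^[k] p).1, d * (fareyStep^[k] p).2) := by
  induction k generalizing p with
  | zero => rfl
  | succ k ih =>
    rw [Function.iterate_succ_apply, Function.iterate_succ_apply, ← ih]
    simp [fareyStep, ← Nat.mul_sub, Nat.mul_min_mul_left, Nat.mul_max_mul_left]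

theorem dep_mul {d : ℕ} (hd : 0 < d) (a b : ℕ) : dep (d * a) (d * b) = dep a b := by
  unfold dep
  congr 1
  ext k
  have h := iterate_fareyStep_mul d k (a, b)
  simp only at h
  simp [h, hd.ne']

/-- One step of the subtractive Euclidean algorithm on `(x, y)`, with the coefficients `(q, s)`
changed so that `x * q + y * s` is preserved. -/
def slowEuclid (t : ℕ × ℕ × ℕ × ℕ) : ℕ × ℕ × ℕ × ℕ :=
  if t.1 < t.2.1 then (t.1, t.2.1 - t.1, t.2.2.1 + t.2.2.2, t.2.2.2)
  else (t.1 - t.2.1, t.2.1, t.2.2.1, t.2.2.1 + t.2.2.2)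

/-- The inverse of `slowEuclid`. -/
def slowEuclidInv (t : ℕ × ℕ × ℕ × ℕ) : ℕ × ℕ × ℕ × ℕ :=
  if t.2.2.2 < t.2.2.1 then (t.1, t.1 + t.2.1, t.2.2.1 - t.2.2.2, t.2.2.2)
  else (t.1 + t.2.1, t.2.1, t.2.2.1, t.2.2.2 - t.2.2.1)

theorem slowEuclid_mem {n : ℕ} {t : ℕ × ℕ × ℕ × ℕ}
    (ht : t ∈ (quads n).filter fun t => t.1 ≠ t.2.1) :
    slowEuclid t ∈ (quads n).filter fun t => t.2.2.1 ≠ t.2.2.2 := by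
  obtain ⟨x, y, q, s⟩ := t
  simp only [Finset.mem_filter, mem_quads] at ht
  obtain ⟨⟨hx, hy, hq, hs, h⟩, hne⟩ := ht
  rcases lt_or_gt_of_ne hne with hlt | hlt
  · obtain ⟨z, rfl⟩ := Nat.exists_eq_add_of_lt hlt
    simp only [slowEuclid, if_pos hlt, Finset.mem_filter, mem_quads]
    refine ⟨⟨hx, by omega, by omega, hs, ?_⟩, by omega⟩
    rw [← h, show x + z + 1 - x = z + 1 by omega]
    ring
  · obtain ⟨z, rfl⟩ := Nat.exists_eq_add_of_lt hlt
    simp only [slowEuclid, if_neg hlt.not_gt, Finset.mem_filter, mem_quads]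
    refine ⟨⟨by omega, hy, hq, by omega, ?_⟩, by omega⟩
    rw [← h, show y + z + 1 - y = z + 1 by omega]
    ring

theorem slowEuclidInv_mem {n : ℕ} {t : ℕ × ℕ × ℕ × ℕ}
    (ht : t ∈ (quads n).filter fun t => t.2.2.1 ≠ t.2.2.2) :
    slowEuclidInv t ∈ (quads n).filter fun t => t.1 ≠ t.2.1 := by
  obtain ⟨x, y, q, s⟩ := t
  simp only [Finset.mem_filter, mem_quads] at ht
  obtain ⟨⟨hx, hy, hq, hs, h⟩, hne⟩ := ht
  rcases lt_or_gt_of_ne hne with hlt | hlt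
  · obtain ⟨z, rfl⟩ := Nat.exists_eq_add_of_lt hlt
    simp only [slowEuclidInv, if_neg hlt.not_gt, Finset.mem_filter, mem_quads]
    refine ⟨⟨by omega, hy, hq, by omega, ?_⟩, by omega⟩
    rw [← h, show q + z + 1 - q = z + 1 by omega]
    ring
  · obtain ⟨z, rfl⟩ := Nat.exists_eq_add_of_lt hlt
    simp only [slowEuclidInv, if_pos hlt, Finset.mem_filter, mem_quads]
    refine ⟨⟨hx, by omega, by omega, hs, ?_⟩, by omega⟩
    rw [← h, show s + z + 1 - s = z + 1 by omega]
    ring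

theorem slowEuclidInv_slowEuclid {n : ℕ} {t : ℕ × ℕ × ℕ × ℕ}
    (ht : t ∈ (quads n).filter fun t => t.1 ≠ t.2.1) :
    slowEuclidInv (slowEuclid t) = t := by
  obtain ⟨x, y, q, s⟩ := t
  simp only [Finset.mem_filter, mem_quads] at ht
  obtain ⟨⟨hx, hy, hq, hs, -⟩, hne⟩ := ht
  rcases lt_or_gt_of_ne hne with hlt | hlt
  · simp [slowEuclid, slowEuclidInv, hlt, hq, hlt.le]
  · simp [slowEuclid, slowEuclidInv, hlt.not_gt, hlt.le]

theorem slowEuclid_slowEuclidInv {n : ℕ} {t : ℕ × ℕ × ℕ × ℕ}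
    (ht : t ∈ (quads n).filter fun t => t.2.2.1 ≠ t.2.2.2) :
    slowEuclid (slowEuclidInv t) = t := by
  obtain ⟨x, y, q, s⟩ := t
  simp only [Finset.mem_filter, mem_quads] at ht
  obtain ⟨⟨hx, hy, hq, hs, -⟩, hne⟩ := ht
  rcases lt_or_gt_of_ne hne with hlt | hlt
  · simp [slowEuclid, slowEuclidInv, hlt.not_gt, hlt.le]
  · simp [slowEuclid, slowEuclidInv, hlt, hy, hlt.le]

theorem dep_slowEuclid {n : ℕ} {t : ℕ × ℕ × ℕ × ℕ}
    (ht : t ∈ (quads n).filter fun t => t.1 ≠ t.2.1) :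
    dep t.1 (t.1 + t.2.1) =
      dep (slowEuclid t).1 ((slowEuclid t).1 + (slowEuclid t).2.1) + 1 := by
  obtain ⟨x, y, q, s⟩ := t
  simp only [Finset.mem_filter, mem_quads] at ht
  obtain ⟨⟨hx, hy, -⟩, hne⟩ := ht
  rcases lt_or_gt_of_ne hne with hlt | hlt
  · simp only [slowEuclid, if_pos hlt]
    rw [dep_add_of_lt hx hlt, Nat.add_sub_cancel' hlt.le]
  · simp only [slowEuclid, if_neg hlt.not_gt]
    rw [dep_add_comm, add_comm x y, dep_add_of_lt hy hlt, dep_add_comm (x - y) y,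
      Nat.sub_add_cancel hlt.le]

theorem sum_dep_sub_one_quads (n : ℕ) :
    ∑ t ∈ (quads n).filter (fun t => t.2.2.1 = t.2.2.2), ((dep t.1 (t.1 + t.2.1) : ℤ) - 1) =
      ((quads n).filter fun t => t.1 ≠ t.2.1).card := by
  have hparts := Finset.sum_filter_add_sum_filter_not (quads n) (fun t => t.1 = t.2.1)
    fun t => (dep t.1 (t.1 + t.2.1) : ℤ) - 1
  have hcoeffs := Finset.sum_filter_add_sum_filter_not (quads n) (fun t => t.2.2.1 = t.2.2.2)
    fun t => (dep t.1 (t.1 + t.2.1) : ℤ) - 1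
  have hzero : ∑ t ∈ (quads n).filter (fun t => t.1 = t.2.1),
      ((dep t.1 (t.1 + t.2.1) : ℤ) - 1) = 0 := by
    refine Finset.sum_eq_zero ?_
    rintro ⟨x, y, q, s⟩ ht
    simp only [Finset.mem_filter, mem_quads] at ht
    obtain ⟨⟨hx, -⟩, rfl⟩ := ht
    simp [dep_self_add_self hx]
  have hstep : ∑ t ∈ (quads n).filter (fun t => t.1 ≠ t.2.1),
      (((dep t.1 (t.1 + t.2.1) : ℤ) - 1) - 1) =
      ∑ t ∈ (quads n).filter (fun t => t.2.2.1 ≠ t.2.2.2),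
        ((dep t.1 (t.1 + t.2.1) : ℤ) - 1) :=
    Finset.sum_nbij' slowEuclid slowEuclidInv (fun _ => slowEuclid_mem)
      (fun _ => slowEuclidInv_mem) (fun _ => slowEuclidInv_slowEuclid)
      (fun _ => slowEuclid_slowEuclidInv)
      fun t ht => by rw [dep_slowEuclid ht]; push_cast; ring
  rw [Finset.sum_sub_distrib] at hstep
  simp only [Finset.sum_const, nsmul_eq_mul, mul_one] at hstep
  simp only [ne_eq] at *
  linarith

theorem two_mul_p2 (n : ℕ) : 2 * p2 n = ((quads n).filter fun t => t.1 ≠ t.2.1).card := by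
  have hp : p2 n = ((quads n).filter fun t => t.2.1 < t.1).card := by
    rw [p2, ← Set.ncard_coe_finset]
    congr 1
    ext ⟨x, y, q, s⟩
    simp only [IsTwoPart, Set.mem_ofPred_eq, Finset.mem_coe, Finset.mem_filter, mem_quads,
      mul_comm q, mul_comm s]
    constructor
    · rintro ⟨hy, hlt, hq, hs, h⟩
      exact ⟨⟨by omega, hy, hq, hs, h⟩, hlt⟩
    · rintro ⟨⟨-, hy, hq, hs, h⟩, hlt⟩
      exact ⟨hy, hlt, hq, hs, h⟩
  have hswap : ((quads n).filter fun t => t.2.1 < t.1).card =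
      ((quads n).filter fun t => t.1 < t.2.1).card := by
    refine Finset.card_nbij' (fun t => (t.2.1, t.1, t.2.2.2, t.2.2.1))
      (fun t => (t.2.1, t.1, t.2.2.2, t.2.2.1)) ?_ ?_ (fun _ _ => rfl) (fun _ _ => rfl) <;>
    · rintro ⟨x, y, q, s⟩ ht
      simp only [Finset.coe_filter, Set.mem_ofPred_eq, mem_quads] at ht ⊢
      obtain ⟨⟨hx, hy, hq, hs, h⟩, hlt⟩ := ht
      exact ⟨⟨hy, hx, hs, hq, by rw [← h, add_comm]⟩, hlt⟩
  simp only [ne_iff_lt_or_gt]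
  rw [Finset.filter_or, Finset.card_union_of_disjoint, ← hswap, hp, two_mul]
  exact Finset.disjoint_filter.2 fun t _ h => h.not_gt

theorem sum_dep_sub_one_mul_card_divisors (n : ℕ) :
    ∑ r ∈ Finset.Ico 1 n, ((dep r n : ℤ) - 1) * ((Nat.gcd r n).divisors.card : ℤ) =
      ∑ t ∈ (quads n).filter (fun t => t.2.2.1 = t.2.2.2),
        ((dep t.1 (t.1 + t.2.1) : ℤ) - 1) := by
  have h : ∀ r ∈ Finset.Ico 1 n, ((dep r n : ℤ) - 1) * ((Nat.gcd r n).divisors.card : ℤ) =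
      ∑ _d ∈ (Nat.gcd r n).divisors, ((dep r n : ℤ) - 1) := fun r _ => by
    rw [Finset.sum_const, nsmul_eq_mul, mul_comm]
  rw [Finset.sum_congr rfl h, Finset.sum_sigma']
  refine Finset.sum_nbij' (fun p => (p.1 / p.2, (n - p.1) / p.2, p.2, p.2))
    (fun t => ⟨t.2.2.1 * t.1, t.2.2.1⟩) ?_ ?_ ?_ ?_ ?_
  · rintro ⟨r, d⟩ hp
    simp only [Finset.mem_sigma, Finset.mem_Ico, Nat.mem_divisors, Nat.dvd_gcd_iff] at hp
    obtain ⟨⟨hr, hrn⟩, ⟨hdr, hdn⟩, -⟩ := hp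
    have hdnr := Nat.dvd_sub hdn hdr
    simp only [Finset.mem_filter, mem_quads, and_true]
    have hd := Nat.pos_of_dvd_of_pos hdr hr
    refine ⟨Nat.div_pos (Nat.le_of_dvd hr hdr) hd,
      Nat.div_pos (Nat.le_of_dvd (by omega) hdnr) hd, hd, hd, ?_⟩
    rw [Nat.div_mul_cancel hdr, Nat.div_mul_cancel hdnr]
    omega
  · rintro ⟨x, y, q, s⟩ ht
    simp only [Finset.mem_filter, mem_quads] at ht
    obtain ⟨⟨hx, hy, hq, -, rfl⟩, rfl⟩ := ht
    have hxq := Nat.mul_pos hx hq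
    have hyq := Nat.mul_pos hy hq
    simp only [Finset.mem_sigma, Finset.mem_Ico, Nat.mem_divisors, Nat.dvd_gcd_iff, mul_comm q]
    refine ⟨⟨hxq, by omega⟩, ⟨⟨Dvd.intro_left _ rfl, ?_⟩, ?_⟩⟩
    · exact dvd_add (Dvd.intro_left _ rfl) (Dvd.intro_left _ rfl)
    · exact (Nat.gcd_pos_of_pos_left _ hxq).ne'
  · rintro ⟨r, d⟩ hp
    simp only [Finset.mem_sigma, Nat.mem_divisors, Nat.dvd_gcd_iff] at hp
    simp only [Nat.mul_div_cancel' hp.2.1.1]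
  · rintro ⟨x, y, q, s⟩ ht
    simp only [Finset.mem_filter, mem_quads] at ht
    obtain ⟨⟨hx, hy, hq, -, rfl⟩, rfl⟩ := ht
    simp [mul_comm q x, Nat.mul_div_cancel _ hq]
  · rintro ⟨r, d⟩ hp
    simp only [Finset.mem_sigma, Finset.mem_Ico, Nat.mem_divisors, Nat.dvd_gcd_iff] at hp
    obtain ⟨⟨hr, hrn⟩, ⟨hdr, hdn⟩, -⟩ := hp
    have hd := Nat.pos_of_dvd_of_pos hdr hr
    simp only
    rw [← dep_mul hd (r / d), mul_add, Nat.mul_div_cancel' hdr,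
      Nat.mul_div_cancel' (Nat.dvd_sub hdn hdr), Nat.add_sub_cancel' hrn.le]

/-- For every `n ≥ 2`,
`2·p(2, n) = Σ_{r=1}^{n−1} (dep(r/n) − 1)·σ₀(gcd(r, n))`,
where `σ₀(d)` is the number of divisors of `d`. -/
theorem p2_formula (n : ℕ) (hn : 2 ≤ n) :
    (2 * p2 n : ℤ) =
      ∑ r ∈ Finset.Ico 1 n, ((dep r n : ℤ) - 1) * ((Nat.gcd r n).divisors.card : ℤ) := by
  rw [sum_dep_sub_one_mul_card_divisors, sum_dep_sub_one_quads, ← two_mul_p2]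
  push_cast
  rfl
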